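/- Let E be a complex Banach space and T(t), t ∈ ℝ, a strongly continuous one-parameter group of isometries on E with generator D. If f ∈ ⋂_k dom(D^k) and there exist constants C > 0 and σ > 0 with ‖D^k f‖ ≤ C σ^k for all k ∈ ℕ, then ‖D^k f‖ ≤ σ^k ‖f‖ for all k ∈ ℕ. -/

import Mathlib

open Filter

namespace BernsteinAux

open Complex Set Topology

/-- Phragmen-Lindelof consequence in the right half-plane. -/
lemma half_plane {q : ℂ → ℂ} (hq : Differentiable ℂ q) {C σ m : ℝ}
    (hσ : 0 < σ) (hexp : ∀ w, ‖q w‖ ≤ C * Real.exp (σ * ‖w‖))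
    (him : ∀ x : ℝ, ‖q (x * I)‖ ≤ m) {w : ℂ} (hw : 0 ≤ w.re) :
    ‖q w‖ ≤ m * Real.exp (σ * w.re) := by
  have key : ‖q w * cexp (-(σ * w))‖ ≤ m := by
    refine PhragmenLindelof.right_half_plane_of_bounded_on_real
      (f := fun w => q w * cexp (-(σ * w))) ?_ ⟨1, by norm_num, σ, ?_⟩ ?_ ?_ hw
    · apply Differentiable.diffContOnCl
      fun_prop
    · apply Asymptotics.IsBigO.of_bound C
      rw [eventually_inf_principal]
      refine Eventually.of_forall fun z hz => ?_
      simp only [Set.mem_ofPred_eq] at hz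
      have h1 : ‖cexp (-(σ * z))‖ ≤ 1 := by
        rw [Complex.norm_exp]
        simp only [neg_re, re_ofReal_mul, Real.exp_le_one_iff]
        have := mul_pos hσ hz
        linarith
      rw [norm_mul, Real.rpow_one, Real.norm_of_nonneg (Real.exp_pos _).le]
      calc ‖q z‖ * ‖cexp (-(σ * z))‖ ≤ ‖q z‖ * 1 := by gcongr
        _ ≤ _ := by rw [mul_one]; exact hexp z
    · refine ⟨C, ?_⟩
      rw [eventually_map]
      filter_upwards [eventually_ge_atTop (0 : ℝ)] with x hx
      rw [norm_mul, Complex.norm_exp]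
      simp only [neg_re, re_ofReal_mul, ofReal_re]
      have h := hexp x
      rw [Complex.norm_real, Real.norm_of_nonneg hx] at h
      rw [Real.exp_neg, ← div_eq_mul_inv, div_le_iff₀ (Real.exp_pos _)]
      exact h
    · intro x
      rw [norm_mul, Complex.norm_exp]
      simpa using him x
  rw [norm_mul, Complex.norm_exp] at key
  simp only [neg_re, re_ofReal_mul] at key
  rwa [Real.exp_neg, ← div_eq_mul_inv, div_le_iff₀ (Real.exp_pos _)] at key

lemma both {q : ℂ → ℂ} (hq : Differentiable ℂ q) {C σ m : ℝ}
    (hσ : 0 < σ) (hexp : ∀ w, ‖q w‖ ≤ C * Real.exp (σ * ‖w‖))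
    (him : ∀ x : ℝ, ‖q (x * I)‖ ≤ m) (w : ℂ) :
    ‖q w‖ ≤ m * Real.exp (σ * |w.re|) := by
  rcases le_total 0 w.re with h | h
  · rw [abs_of_nonneg h]; exact half_plane hq hσ hexp him h
  · have := half_plane (q := fun w => q (-w)) (by fun_prop) hσ
      (fun w => by simpa using hexp (-w)) (fun x => by simpa using him (-x))
      (w := -w) (by simpa using h)
    rw [abs_of_nonpos h]
    simpa using this

lemma reflect {q : ℂ → ℂ} (hq : Differentiable ℂ q) {C σ m : ℝ} (hm : m < 1)
    (hσ : 0 < σ) (hexp : ∀ w, ‖q w‖ ≤ C * Real.exp (σ * ‖w‖))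
    (him : ∀ x : ℝ, ‖q (x * I)‖ ≤ m) (β : ℂ) (hβ : ‖β‖ = 1) {h : ℝ} (hh : 0 ≤ h) :
    ‖β * cexp (σ * (-h : ℝ)) - q (-h : ℝ)‖ ≤ ‖β * cexp (σ * h) - q h‖ := by
  have hm0 : 0 ≤ m := (norm_nonneg _).trans (him 0)
  set p : ℂ → ℂ := fun w => β * cexp (σ * w) - q w with hp
  have hpd : Differentiable ℂ p := by fun_prop
  have hlow : ∀ w : ℂ, 0 ≤ w.re → (1 - m) * Real.exp (σ * w.re) ≤ ‖p w‖ := by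
    intro w hw
    have h1 := half_plane hq hσ hexp him hw
    have h2 := norm_sub_norm_le (β * cexp (σ * w)) (q w)
    rw [norm_mul, hβ, Complex.norm_exp] at h2
    simp only [re_ofReal_mul] at h2
    simp only [hp]
    linarith
  have hpos : ∀ w : ℂ, 0 ≤ w.re → 0 < ‖p w‖ := fun w hw =>
    lt_of_lt_of_le (mul_pos (by linarith) (Real.exp_pos _)) (hlow w hw)
  set r : ℂ → ℂ := fun w => (starRingEnd ℂ) (p (-(starRingEnd ℂ) w)) with hr
  have hrd : Differentiable ℂ r := by
    intro w
    have : DifferentiableAt ℂ (fun w => p (-w)) ((starRingEnd ℂ) w) := by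
      have : Differentiable ℂ (fun w => p (-w)) := by fun_prop
      exact this _
    have := this.conj_conj
    simpa [hr, Function.comp_def] using this
  have hbd : ∀ w : ℂ, 0 ≤ w.re → ‖r w / p w‖ ≤ (1 + m) / (1 - m) := by
    intro w hw
    have h1 := both hq hσ hexp him (-(starRingEnd ℂ) w)
    have h2 := norm_sub_le (β * cexp (σ * (-(starRingEnd ℂ) w))) (q (-(starRingEnd ℂ) w))
    have h3 := hlow w hw
    rw [norm_mul, hβ, Complex.norm_exp] at h2
    simp only [re_ofReal_mul, neg_re, conj_re, abs_neg, abs_of_nonneg hw] at h1 h2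
    have h4 : Real.exp (σ * -w.re) ≤ Real.exp (σ * w.re) := by
      apply Real.exp_le_exp.2
      have := mul_nonneg hσ.le hw
      linarith
    have h5 : ‖r w‖ ≤ (1 + m) * Real.exp (σ * w.re) := by
      simp only [hr, RCLike.norm_conj, hp]
      linarith
    rw [norm_div, div_le_div_iff₀ (hpos w hw) (by linarith)]
    calc ‖r w‖ * (1 - m) ≤ ((1 + m) * Real.exp (σ * w.re)) * (1 - m) := by
          apply mul_le_mul_of_nonneg_right h5; linarith
      _ = (1 + m) * ((1 - m) * Real.exp (σ * w.re)) := by ring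
      _ ≤ _ := by apply mul_le_mul_of_nonneg_left h3; linarith
  have key : ‖r h / p h‖ ≤ 1 := by
    refine PhragmenLindelof.right_half_plane_of_bounded_on_real
      (f := fun w => r w / p w) ?_ ⟨1, by norm_num, 0, ?_⟩ ?_ ?_ (by simpa using hh)
    · apply DifferentiableOn.diffContOnCl
      intro w hw
      have hw' : 0 ≤ w.re := by
        have : closure {z : ℂ | 0 < z.re} ⊆ {z : ℂ | 0 ≤ z.re} :=
          closure_minimal (fun z (hz : 0 < z.re) => show 0 ≤ z.re from le_of_lt hz)
            (isClosed_le continuous_const Complex.continuous_re)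
        exact this hw
      exact ((hrd w).div (hpd w) (norm_pos_iff.1 (hpos w hw'))).differentiableWithinAt
    · apply Asymptotics.IsBigO.of_bound ((1 + m) / (1 - m))
      rw [eventually_inf_principal]
      refine Eventually.of_forall fun z hz => ?_
      simpa using hbd z (le_of_lt hz)
    · refine ⟨(1 + m) / (1 - m), ?_⟩
      rw [eventually_map]
      filter_upwards [eventually_ge_atTop (0 : ℝ)] with x hx
      exact hbd x (by simpa using hx)
    · intro x
      have : r (x * I) = (starRingEnd ℂ) (p (x * I)) := by simp [hr]
      rw [this, norm_div, RCLike.norm_conj]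
      exact div_self_le_one _
  rw [norm_div, div_le_one (hpos h (by simpa using hh))] at key
  have e : ‖r h‖ = ‖p ((-h : ℝ) : ℂ)‖ := by
    simp only [hr, RCLike.norm_conj, conj_ofReal, ofReal_neg]
  rw [e] at key
  exact key

lemma alg {q0 v : ℂ} (hq0 : ‖q0‖ < 1)
    (H : ∀ β : ℂ, ‖β‖ = 1 → 0 ≤ ((starRingEnd ℂ) (β - q0) * (β - v)).re) : ‖v‖ ≤ 1 := by
  by_cases hz : q0 + v = 0
  · have : v = -q0 := by linear_combination hz
    rw [this, norm_neg]; exact hq0.le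
  have hn : 0 < ‖q0 + v‖ := norm_pos_iff.2 hz
  set n := ‖q0 + v‖ with hnd
  have hn2 : n ^ 2 = (q0.re + v.re) ^ 2 + (q0.im + v.im) ^ 2 := by
    rw [hnd, Complex.sq_norm, Complex.normSq_apply]; simp; ring
  have h := H ((q0 + v) / n) (by
    rw [norm_div, Complex.norm_real, Real.norm_of_nonneg hn.le]; exact div_self hn.ne')
  have e : ((starRingEnd ℂ) ((q0 + v) / n - q0) * ((q0 + v) / n - v)).re
      = 1 - n + (q0.re * v.re + q0.im * v.im) := by
    have : (q0 + v) / (n : ℂ) = ((n⁻¹ : ℝ) : ℂ) * (q0 + v) := by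
      push_cast; field_simp
    rw [this]
    have hk : n⁻¹ * n = 1 := inv_mul_cancel₀ hn.ne'
    simp only [map_sub, map_mul, map_add, conj_ofReal, mul_re, sub_re, sub_im, mul_im, add_re,
      add_im, conj_re, conj_im, ofReal_re, ofReal_im]
    linear_combination (-n⁻¹ ^ 2 + n⁻¹) * hn2 + (n⁻¹ * n + 1 - n) * hk
  rw [e] at h
  have hq : ‖q0‖ ^ 2 = q0.re ^ 2 + q0.im ^ 2 := by
    rw [Complex.sq_norm, Complex.normSq_apply]; ring
  have hv : ‖v‖ ^ 2 = v.re ^ 2 + v.im ^ 2 := by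
    rw [Complex.sq_norm, Complex.normSq_apply]; ring
  have h2 : n ^ 2 ≤ (1 + (q0.re * v.re + q0.im * v.im)) ^ 2 :=
    pow_le_pow_left₀ hn.le (by linarith) 2
  have h3 : (q0.re * v.re + q0.im * v.im) ^ 2 ≤ ‖q0‖ ^ 2 * ‖v‖ ^ 2 := by
    rw [hq, hv]; nlinarith [sq_nonneg (q0.re * v.im - q0.im * v.re)]
  by_contra hc
  push Not at hc
  have h4 : 0 < (1 - ‖q0‖ ^ 2) * (‖v‖ ^ 2 - 1) := by
    apply mul_pos
    · nlinarith [norm_nonneg q0]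
    · nlinarith
  nlinarith

lemma bern {q : ℂ → ℂ} (hq : Differentiable ℂ q) {C σ m : ℝ} (hm : m < 1)
    (hσ : 0 < σ) (hexp : ∀ w, ‖q w‖ ≤ C * Real.exp (σ * ‖w‖))
    (him : ∀ x : ℝ, ‖q (x * I)‖ ≤ m) : ‖deriv q 0‖ ≤ σ := by
  have hσ' : (σ : ℂ) ≠ 0 := by exact_mod_cast hσ.ne'
  have h : ‖deriv q 0 / σ‖ ≤ 1 := by
    apply alg (q0 := q 0) (lt_of_le_of_lt (by simpa using him 0) hm)
    intro β hβ
    have hd : HasDerivAt (fun w : ℂ => β * cexp (σ * w) - q w) (β * σ - deriv q 0) ((0 : ℝ) : ℂ) := by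
      have h1 : HasDerivAt (fun w : ℂ => cexp (σ * w)) (cexp (σ * (0:ℝ)) * (σ * 1)) ((0:ℝ):ℂ) :=
        ((hasDerivAt_id _).const_mul (σ : ℂ)).cexp
      have h2 := (h1.const_mul β).sub (hq ((0:ℝ):ℂ)).hasDerivAt
      refine h2.congr_deriv ?_
      simp
    have hr := hd.comp_ofReal
    have hl : HasDerivAt (fun x : ℝ => β * cexp (σ * ((-x : ℝ) : ℂ)) - q ((-x : ℝ) : ℂ))
        (-(β * σ - deriv q 0)) 0 := by
      have h0 : HasDerivAt (fun x : ℝ => β * cexp (σ * (x : ℂ)) - q (x : ℂ))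
        (β * σ - deriv q 0) (-(0:ℝ)) := by simpa using hr
      have := h0.scomp (0:ℝ) (hasDerivAt_neg (0:ℝ))
      simpa [Function.comp_def] using this
    have hψ := hr.norm_sq.sub hl.norm_sq
    have hψ' := hψ.tendsto_slope_zero_right
    have hnn := ge_of_tendsto (b := (0 : ℝ)) hψ' (by
      filter_upwards [self_mem_nhdsWithin] with t ht
      have ht' : (0:ℝ) < t := ht
      have := reflect hq hm hσ hexp him β hβ ht'.le
      have h2 := pow_le_pow_left₀ (norm_nonneg _) this 2
      simp only [smul_eq_mul]
      apply mul_nonneg (by positivity)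
      have h3 : ‖β * cexp (σ * ((-(0:ℝ) : ℝ) : ℂ)) - q ((-(0:ℝ) : ℝ) : ℂ)‖
        = ‖β * cexp (σ * ((0 : ℝ) : ℂ)) - q ((0 : ℝ) : ℂ)‖ := by rw [neg_zero]
      simp only [Pi.sub_apply, zero_add, h3]
      linarith)
    simp only [Complex.inner, ofReal_zero, neg_zero, mul_zero, Complex.exp_zero, mul_one,
      neg_mul, mul_neg, neg_re, sub_neg_eq_add] at hnn
    have e : (starRingEnd ℂ) (β - q 0) * (β * σ - deriv q 0)
        = (σ : ℂ) * ((starRingEnd ℂ) (β - q 0) * (β - deriv q 0 / σ)) := by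
      field_simp
    first
      | rw [e] at hnn
      | (rw [mul_comm (β * σ - deriv q 0), e] at hnn)
    rw [re_ofReal_mul] at hnn
    by_contra hc
    push Not at hc
    nlinarith
  rw [norm_div, Complex.norm_real, Real.norm_of_nonneg hσ.le, div_le_one hσ] at h
  exact h

lemma taylor_bound {u : ℕ → ℝ → ℂ} (hu : ∀ k t, HasDerivAt (u k) (u (k + 1) t) t)
    {C σ : ℝ} (hb : ∀ k t, ‖u k t‖ ≤ C * σ ^ k) (n : ℕ) : ∀ k : ℕ, ∀ t : ℝ, 0 ≤ t →
    ‖u k t - ∑ j ∈ Finset.range n, (t : ℂ) ^ j / (j.factorial : ℂ) * u (k + j) 0‖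
      ≤ C * σ ^ (k + n) * (t ^ n / n.factorial) := by
  induction n with
  | zero => intro k t _; simpa using hb k t
  | succ n ih =>
    intro k t ht
    have hfac : ∀ j : ℕ, (((j + 1).factorial : ℕ) : ℂ) = ((j : ℂ) + 1) * (j.factorial : ℂ) := by
      intro j; rw [Nat.factorial_succ]; push_cast; ring
    have hfacR : ∀ j : ℕ, (((j + 1).factorial : ℕ) : ℝ) = ((j : ℝ) + 1) * (j.factorial : ℝ) := by
      intro j; rw [Nat.factorial_succ]; push_cast; ring
    have hder : ∀ s : ℝ, HasDerivAt
        (fun s : ℝ => u k s - ∑ j ∈ Finset.range (n + 1), (s : ℂ) ^ j / (j.factorial : ℂ) * u (k + j) 0)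
        (u (k + 1) s - ∑ j ∈ Finset.range n, (s : ℂ) ^ j / (j.factorial : ℂ) * u (k + 1 + j) 0) s := by
      intro s
      refine (hu k s).sub ?_
      simp only [Finset.sum_range_succ', pow_zero]
      refine HasDerivAt.add_const (𝕜 := ℝ) (F := ℂ) _ ?_
      refine HasDerivAt.fun_sum (𝕜 := ℝ) (F := ℂ) fun j _ => ?_
      have h1 : HasDerivAt (fun z : ℂ => z ^ (j + 1)) (((j + 1 : ℕ) : ℂ) * (s : ℂ) ^ j) (s : ℂ) := by
        simpa using hasDerivAt_pow (j + 1) (s : ℂ)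
      have h2 := ((h1.comp_ofReal).div_const (((j + 1).factorial : ℕ) : ℂ)).mul_const
        (u (k + (j + 1)) 0)
      refine h2.congr_deriv ?_
      have e : k + 1 + j = k + (j + 1) := by ring
      rw [e, hfac]
      have : (j : ℂ) + 1 ≠ 0 := by exact_mod_cast Nat.succ_ne_zero j
      have : (j.factorial : ℂ) ≠ 0 := by exact_mod_cast Nat.factorial_ne_zero j
      push_cast
      field_simp
    have hB : ∀ s : ℝ, HasDerivAt (fun s : ℝ => C * σ ^ (k + (n + 1)) * (s ^ (n + 1) / (n + 1).factorial))
        (C * σ ^ (k + 1 + n) * (s ^ n / n.factorial)) s := by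
      intro s
      have h1 := ((hasDerivAt_pow (n + 1) s).div_const (((n + 1).factorial : ℕ) : ℝ)).const_mul
        (C * σ ^ (k + (n + 1)))
      refine h1.congr_deriv ?_
      have e : k + 1 + n = k + (n + 1) := by ring
      rw [e, hfacR]
      have : (n : ℝ) + 1 ≠ 0 := by exact_mod_cast Nat.succ_ne_zero n
      have : (n.factorial : ℝ) ≠ 0 := by exact_mod_cast Nat.factorial_ne_zero n
      push_cast
      field_simp
    refine image_norm_le_of_norm_deriv_right_le_deriv_boundary (a := 0) (b := t)
      (fun s _ => (hder s).continuousAt.continuousWithinAt)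
      (fun s _ => (hder s).hasDerivWithinAt) ?_ hB (fun s hs => ih (k + 1) s hs.1) ⟨ht, le_rfl⟩
    simp [Finset.sum_range_succ']

lemma taylor_pos {u : ℕ → ℝ → ℂ} (hu : ∀ k t, HasDerivAt (u k) (u (k + 1) t) t)
    {C σ : ℝ} (hb : ∀ k t, ‖u k t‖ ≤ C * σ ^ k) {t : ℝ} (ht : 0 ≤ t) :
    Tendsto (fun n => ∑ j ∈ Finset.range n, (t : ℂ) ^ j / (j.factorial : ℂ) * u j 0) atTop
      (𝓝 (u 0 t)) := by
  rw [tendsto_iff_norm_sub_tendsto_zero]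
  have h0 : Tendsto (fun n : ℕ => C * ((σ * t) ^ n / (n.factorial : ℝ))) atTop (𝓝 0) := by
    simpa using (FloorSemiring.tendsto_pow_div_factorial_atTop (σ * t)).const_mul C
  refine squeeze_zero (fun _ => norm_nonneg _) (fun n => ?_) h0
  have := taylor_bound hu hb n 0 t ht
  rw [norm_sub_rev]
  simp only [zero_add] at this
  refine this.trans (le_of_eq ?_)
  rw [mul_pow]; ring

lemma taylor {u : ℕ → ℝ → ℂ} (hu : ∀ k t, HasDerivAt (u k) (u (k + 1) t) t)
    {C σ : ℝ} (hb : ∀ k t, ‖u k t‖ ≤ C * σ ^ k) (t : ℝ) :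
    Tendsto (fun n => ∑ j ∈ Finset.range n, (t : ℂ) ^ j / (j.factorial : ℂ) * u j 0) atTop
      (𝓝 (u 0 t)) := by
  rcases le_total 0 t with ht | ht
  · exact taylor_pos hu hb ht
  · have := taylor_pos (u := fun k s => (-1) ^ k * u k (-s)) (C := C) (σ := σ) (fun k s => by
        have h := ((hu k (-s)).scomp s (hasDerivAt_neg s)).const_mul ((-1 : ℂ) ^ k)
        refine h.congr_deriv ?_
        simp [pow_succ]) (fun k s => by simpa using hb k (-s)) (t := -t) (by linarith)
    simp only [neg_neg, pow_zero, one_mul, neg_zero] at this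
    refine this.congr fun n => Finset.sum_congr rfl fun j _ => ?_
    have : ((-t : ℝ) : ℂ) ^ j * (-1) ^ j = (t : ℂ) ^ j := by
      rw [← mul_pow]; simp
    rw [← this]; ring

/-- The entire extension. -/
lemma entire (a : ℕ → ℂ) {C σ : ℝ} (hσ : 0 < σ) (ha : ∀ k, ‖a k‖ ≤ C * σ ^ k) :
    ∃ g : ℂ → ℂ, Differentiable ℂ g ∧ (∀ z, ‖g z‖ ≤ C * Real.exp (σ * ‖z‖)) ∧
      deriv g 0 = a 1 ∧
      ∀ z, HasSum (fun j : ℕ => z ^ j / (j.factorial : ℂ) * a j) (g z) := by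
  have hterm : ∀ (R : ℝ) (j : ℕ) (z : ℂ), ‖z‖ ≤ R →
      ‖z ^ j / (j.factorial : ℂ) * a j‖ ≤ C * ((σ * R) ^ j / (j.factorial : ℝ)) := by
    intro R j z hz
    have hC : 0 ≤ C * σ ^ j := (norm_nonneg _).trans (ha j)
    rw [norm_mul, norm_div, norm_pow, Complex.norm_natCast]
    calc ‖z‖ ^ j / (j.factorial : ℝ) * ‖a j‖ ≤ R ^ j / (j.factorial : ℝ) * (C * σ ^ j) := by
          have hR : 0 ≤ R := (norm_nonneg z).trans hz
          exact mul_le_mul (by gcongr) (ha j) (norm_nonneg _) (by positivity)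
      _ = _ := by rw [mul_pow]; ring
  have hsumm : ∀ R : ℝ, HasSum (fun j : ℕ => C * ((σ * R) ^ j / (j.factorial : ℝ)))
      (C * Real.exp (σ * R)) := by
    intro R
    rw [Real.exp_eq_exp_ℝ]
    exact (NormedSpace.expSeries_div_hasSum_exp (σ * R)).mul_left C
  have hs : ∀ z : ℂ, Summable (fun j : ℕ => z ^ j / (j.factorial : ℂ) * a j) := fun z =>
    Summable.of_norm_bounded (hsumm ‖z‖).summable (fun j => hterm _ j z le_rfl)
  have hdf : ∀ j : ℕ, Differentiable ℂ (fun z : ℂ => z ^ j / (j.factorial : ℂ) * a j) := by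
    intro j; fun_prop
  refine ⟨fun z => ∑' j : ℕ, z ^ j / (j.factorial : ℂ) * a j, ?_, ?_, ?_, fun z => (hs z).hasSum⟩
  · intro z
    have := differentiableOn_tsum_of_summable_norm (U := Metric.ball 0 (‖z‖ + 1))
      (F := fun (j : ℕ) (z : ℂ) => z ^ j / (j.factorial : ℂ) * a j)
      (hsumm (‖z‖ + 1)).summable (fun j => (hdf j).differentiableOn) Metric.isOpen_ball
      (fun j w hw => hterm _ j w (by simpa using (le_of_lt (mem_ball_zero_iff.1 hw))))
    exact this.differentiableAt (Metric.isOpen_ball.mem_nhds (by simp))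
  · intro z
    exact tsum_of_norm_bounded (hsumm ‖z‖) (fun j => hterm _ j z le_rfl)
  · have := hasSum_deriv_of_summable_norm (U := Metric.ball 0 1) (z := 0)
      (F := fun (j : ℕ) (z : ℂ) => z ^ j / (j.factorial : ℂ) * a j)
      (hsumm 1).summable (fun j => (hdf j).differentiableOn) Metric.isOpen_ball
      (fun j w hw => hterm _ j w (by simpa using (le_of_lt (mem_ball_zero_iff.1 hw)))) (by simp)
    refine this.unique ?_
    have h1 : HasSum (fun j : ℕ => if j = 1 then a 1 else 0) (a 1) := hasSum_ite_eq 1 (a 1)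
    have hfun : ∀ j : ℕ, deriv (fun z : ℂ => z ^ j / (j.factorial : ℂ) * a j) 0
        = if j = 1 then a 1 else 0 := by
      intro j
      have hd : HasDerivAt (fun z : ℂ => z ^ j / (j.factorial : ℂ) * a j)
          ((j : ℂ) * 0 ^ (j - 1) / (j.factorial : ℂ) * a j) 0 :=
        ((hasDerivAt_pow j (0:ℂ)).div_const _).mul_const _
      rw [hd.deriv]
      rcases j with _ | _ | j <;> simp
    simp only [hfun]
    exact h1

lemma step {E : Type*} [NormedAddCommGroup E] [NormedSpace ℂ E]
    (T : ℝ → E →L[ℂ] E)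
    (hT0 : T 0 = ContinuousLinearMap.id ℂ E)
    (hTiso : ∀ (t : ℝ) (x : E), ‖T t x‖ = ‖x‖)
    (F : ℕ → E)
    (hFD : ∀ (k : ℕ) (t : ℝ), HasDerivAt (fun s : ℝ => T s (F k)) (T t (F (k + 1))) t)
    (C σ : ℝ) (hσ : 0 < σ)
    (hbound : ∀ k : ℕ, ‖F k‖ ≤ C * σ ^ k) : ‖F 1‖ ≤ σ * ‖F 0‖ := by
  obtain ⟨φ, hφ, hφ1⟩ := exists_dual_vector'' ℂ (F 1)
  have hφn : ∀ x, ‖φ x‖ ≤ ‖x‖ := fun x => by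
    simpa using φ.le_of_opNorm_le hφ x
  have hu : ∀ (k : ℕ) (t : ℝ), HasDerivAt (fun s : ℝ => φ (T s (F k))) (φ (T t (F (k + 1)))) t :=
    fun k t => ((φ.restrictScalars ℝ).hasFDerivAt).comp_hasDerivAt t (hFD k t)
  have hb : ∀ (k : ℕ) (t : ℝ), ‖φ (T t (F k))‖ ≤ C * σ ^ k := fun k t =>
    (hφn _).trans ((hTiso t _).le.trans (hbound k))
  obtain ⟨g, hgd, hge, hg1, hgs⟩ := entire (fun k => φ (F k)) hσ
    (fun k => (hφn _).trans (hbound k))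
  have hreal : ∀ t : ℝ, ‖g t‖ ≤ ‖F 0‖ := by
    intro t
    have h1 := taylor (u := fun k s => φ (T s (F k))) hu hb t
    simp only [hT0, ContinuousLinearMap.id_apply] at h1
    have h2 := tendsto_nhds_unique (hgs t).tendsto_sum_nat h1
    rw [h2]
    exact (hφn _).trans (hTiso t _).le
  have main : ∀ M : ℝ, ‖F 0‖ < M → ‖F 1‖ ≤ σ * M := by
    intro M hM
    have hM0 : 0 < M := (norm_nonneg _).trans_lt hM
    have hMn : ‖(M : ℂ)‖ = M := by rw [Complex.norm_real, Real.norm_of_nonneg hM0.le]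
    have h := bern (q := fun w => g (I * w) / M) (C := C / M) (σ := σ) (m := ‖F 0‖ / M)
      (by fun_prop) ((div_lt_one hM0).2 hM) hσ
      (fun w => by
        rw [norm_div, hMn, div_mul_eq_mul_div]
        gcongr
        simpa using hge (I * w))
      (fun x => by
        rw [norm_div, hMn]
        gcongr
        have : I * (x * I) = ((-x : ℝ) : ℂ) := by
          push_cast; linear_combination (x : ℂ) * I_mul_I
        rw [this]; exact hreal _)
    have hd : HasDerivAt (fun w : ℂ => g (I * w) / M) (φ (F 1) * I / M) 0 := by
      have h0 : HasDerivAt g (φ (F 1)) (I * 0) := by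
        have := (hgd 0).hasDerivAt
        rw [hg1] at this
        simpa using this
      have h1 : HasDerivAt (fun w : ℂ => I * w) I 0 := by
        simpa using (hasDerivAt_id (0 : ℂ)).const_mul I
      exact (h0.comp (0 : ℂ) h1).div_const _
    rw [hd.deriv, norm_div, norm_mul, hMn, Complex.norm_I, mul_one, hφ1, div_le_iff₀ hM0] at h
    simpa using h
  refine le_of_forall_pos_le_add fun ε hε => ?_
  have := main (‖F 0‖ + ε / σ) (by have := div_pos hε hσ; linarith)
  rwa [mul_add, mul_div_cancel₀ _ hσ.ne'] at this

end BernsteinAux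

theorem bernstein_minimal_constant {E : Type*} [NormedAddCommGroup E] [NormedSpace ℂ E]
    [CompleteSpace E]
    (T : ℝ → E →L[ℂ] E)
    (hT0 : T 0 = ContinuousLinearMap.id ℂ E)
    (hTadd : ∀ s t : ℝ, T (s + t) = (T s).comp (T t))
    (hTiso : ∀ (t : ℝ) (x : E), ‖T t x‖ = ‖x‖)
    (hTcont : ∀ x : E, Continuous fun t : ℝ => T t x)
    (f : E) (F : ℕ → E) (hF0 : F 0 = f)
    (hFD : ∀ (k : ℕ) (t : ℝ), HasDerivAt (fun s : ℝ => T s (F k)) (T t (F (k + 1))) t)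
    (C σ : ℝ) (hC : 0 < C) (hσ : 0 < σ)
    (hbound : ∀ k : ℕ, ‖F k‖ ≤ C * σ ^ k) :
    ∀ k : ℕ, ‖F k‖ ≤ σ ^ k * ‖f‖ := by
  intro k
  induction k with
  | zero => simp [hF0]
  | succ k ih =>
    have h := BernsteinAux.step T hT0 hTiso (fun j => F (k + j)) (fun j t => hFD (k + j) t)
      (C * σ ^ k) σ hσ (fun j => by rw [mul_assoc, ← pow_add]; exact hbound (k + j))
    simp only [add_zero] at h
    calc ‖F (k + 1)‖ ≤ σ * ‖F k‖ := h
      _ ≤ σ * (σ ^ k * ‖f‖) := by gcongr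
      _ = _ := by ring
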